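/- Player 1 has a winning strategy in the Build Up 1-2-3 game on n = 4. -/

import Mathlib

/-- The Fibonacci numbers indexed so that `zfib 1 = 1`, `zfib 2 = 2`,
and `zfib (i+1) = zfib i + zfib (i-1)`. -/
def zfib (i : ℕ) : ℕ := Nat.fib (i + 1)

/-- A game state: a finitely supported function recording the height of each bin.
Bin indices start at `1`; index `0` is unused. -/
abbrev ZState := ℕ →₀ ℕ

/-- The legal moves of the reversed Zeckendorf game. -/
inductive ZMove : ZState → ZState → Prop
  | split (h : ZState) (i : ℕ) (hi : 2 ≤ i) (hpos : 0 < h (i + 1)) :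
      ZMove h (h - Finsupp.single (i + 1) 1 + Finsupp.single i 1 + Finsupp.single (i - 1) 1)
  | splitTwo (h : ZState) (hpos : 0 < h 2) :
      ZMove h (h - Finsupp.single 2 1 + Finsupp.single 1 2)
  | combine (h : ZState) (i : ℕ) (hi : 2 < i) (h1 : 0 < h (i + 1)) (h2 : 0 < h (i - 2)) :
      ZMove h (h - Finsupp.single (i + 1) 1 - Finsupp.single (i - 2) 1 + Finsupp.single i 2)
  | combineTwo (h : ZState) (h1 : 0 < h 3) (h2 : 0 < h 1) :
      ZMove h (h - Finsupp.single 3 1 - Finsupp.single 1 1 + Finsupp.single 2 2)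

/-- A position of the Build Up 1-2-3 game on `n`: the running total `s` of the
building phase together with the current game state (which during the building
phase records the counts of played 1s, 2s and 3s in bins 1, 2 and 3). -/
abbrev BUPos := ℕ × ZState

/-- The legal moves of the Build Up 1-2-3 game on `n`: while the running total is
below `n`, put down a `1`, `2` or `3` without exceeding `n`; once the total is
exactly `n`, make reversed Zeckendorf moves on the accumulated state. -/
inductive BUMove (n : ℕ) : BUPos → BUPos → Prop
  | build (s : ℕ) (h : ZState) (k : ℕ) (hk : k = 1 ∨ k = 2 ∨ k = 3) (hs : s + k ≤ n) :
      BUMove n (s, h) (s + k, h + Finsupp.single k 1)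
  | play (h h' : ZState) (hm : ZMove h h') : BUMove n (n, h) (n, h')

mutual
  /-- The position is a win for the player to move. -/
  inductive BUFirstWin (n : ℕ) : BUPos → Prop
    | intro (p q : BUPos) (m : BUMove n p q) (hl : BULoss n q) : BUFirstWin n p
  /-- The position is a loss for the player to move. -/
  inductive BULoss (n : ℕ) : BUPos → Prop
    | intro (p : BUPos) (hall : ∀ q, BUMove n p q → BUFirstWin n q) : BULoss n p
end

/-- The state with prescribed heights in bins 1, 2, 3. -/
noncomputable def st (a b c : ℕ) : ZState :=
  Finsupp.single 1 a + Finsupp.single 2 b + Finsupp.single 3 c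

theorem st_apply (a b c j : ℕ) :
    st a b c j = (if j = 1 then a else 0) + (if j = 2 then b else 0) + (if j = 3 then c else 0) := by
  simp only [st, Finsupp.add_apply, Finsupp.single_apply, eq_comm]

theorem moves_full (a b : ℕ) (q : BUPos) (m : BUMove 4 (4, st a b 0) q) :
    0 < b ∧ q = (4, st (a + 2) (b - 1) 0) := by
  cases m with
  | build _ _ k hk hs => omega
  | play _ h' hm =>
    cases hm with
    | split i hi hpos =>
      rw [st_apply] at hpos
      split_ifs at hpos <;> omega
    | splitTwo hpos =>
      refine ⟨by simpa [st_apply] using hpos, ?_⟩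
      congr 1
      ext j
      simp only [st_apply, Finsupp.add_apply, Finsupp.tsub_apply, Finsupp.single_apply]
      split_ifs <;> omega
    | combine i hi h1 h2 =>
      rw [st_apply] at h1
      split_ifs at h1 <;> omega
    | combineTwo h1 h2 =>
      simp [st_apply] at h1

theorem split_move (a b : ℕ) : BUMove 4 (4, st a (b + 1) 0) (4, st (a + 2) b 0) := by
  have h := BUMove.play (n := 4) _ _ (ZMove.splitTwo (st a (b + 1) 0) (by simp [st_apply]))
  rw [(moves_full _ _ _ h).2] at h
  exact h

theorem loss400 : BULoss 4 (4, st 4 0 0) :=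
  .intro _ fun q m => absurd (moves_full _ _ q m).1 (by omega)

theorem win210 : BUFirstWin 4 (4, st 2 1 0) := .intro _ _ (split_move 2 0) loss400

theorem loss020 : BULoss 4 (4, st 0 2 0) :=
  .intro _ fun q m => by
    rw [(moves_full _ _ q m).2]
    exact win210

theorem win101 : BUFirstWin 4 (4, st 1 0 1) := by
  have h := BUMove.play (n := 4) _ _
    (ZMove.combineTwo (st 1 0 1) (by simp [st_apply]) (by simp [st_apply]))
  have e : st 1 0 1 - Finsupp.single 3 1 - Finsupp.single 1 1 + Finsupp.single 2 2 = st 0 2 0 := by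
    ext j
    simp only [st_apply, Finsupp.add_apply, Finsupp.tsub_apply, Finsupp.single_apply]
    split_ifs <;> omega
  rw [e] at h
  exact .intro _ _ h loss020

/-- Player 1 has a winning strategy in the Build Up 1-2-3 game on `n = 4`. -/
theorem buildUpGame_four_firstPlayerWin : BUFirstWin 4 (0, 0) := by
  refine .intro _ _ (.build 0 0 3 (by omega) (by omega)) (.intro _ fun q m => ?_)
  generalize hp : ((0 + 3, 0 + Finsupp.single 3 1) : BUPos) = p at m
  cases m with
  | build s h k hk hs =>
    obtain ⟨h1, h2⟩ := Prod.mk.inj hp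
    subst h2
    have hk1 : k = 1 := by omega
    have hs3 : s = 3 := by omega
    subst hk1 hs3
    have e : (0 + Finsupp.single 3 1 + Finsupp.single 1 1 : ZState) = st 1 0 1 := by
      simp [st, add_comm]
    rw [e]
    exact win101
  | play h h' hm =>
    have := (Prod.mk.inj hp).1
    omega
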